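/- arXiv:2401.03662 — 2 statements merged into one kernel-verified Lean document; each statement's English description precedes it below -/
import Mathlib

section
/- There exists a universal constant C>0 such that for all 0 < r ≤ ρ, every m ∈ ℕ, and every function w : ℝ³ → ℝ^m that is continuously differentiable on a neighborhood of the closed ball of radius ρ centered at the origin, ∫_{B_r(0)}|w|² dx ≤ C[ρ(∫_{B_ρ(0)}|w|² dx)^{1/2}(∫_{B_ρ(0)}|∇w|² dx)^{1/2} + (r/ρ)³∫_{B_ρ(0)}|w|² dx]. -/
open MeasureTheory

/-- Partial derivative in direction `i` of a scalar function on Euclidean `ℝ³`. -/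
noncomputable def pd (i : Fin 3) (g : EuclideanSpace ℝ (Fin 3) → ℝ)
    (x : EuclideanSpace ℝ (Fin 3)) : ℝ :=
  fderiv ℝ g x (EuclideanSpace.single i 1)

lemma Continuous.integrableOn_ball {E F : Type*} [NormedAddCommGroup E] [MeasurableSpace E]
    [BorelSpace E] [ProperSpace E] {μ : Measure E} [IsFiniteMeasureOnCompacts μ]
    [NormedAddCommGroup F] {f : E → F} (hf : Continuous f) (x : E) (R : ℝ) :
    IntegrableOn f (Metric.ball x R) μ :=
  (hf.continuousOn.integrableOn_compact (isCompact_closedBall x R)).mono_set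
    Metric.ball_subset_closedBall

section Dilation

variable {E : Type*} [NormedAddCommGroup E] [NormedSpace ℝ E] [FiniteDimensional ℝ E]
  [MeasurableSpace E] [BorelSpace E] (μ : Measure E) [μ.IsAddHaarMeasure]

lemma setIntegral_ball_comp_smul (f : E → ℝ) {t : ℝ} (ht : 0 < t) (R : ℝ) :
    ∫ x in Metric.ball (0 : E) R, f (t • x) ∂μ
      = (t ^ Module.finrank ℝ E)⁻¹ * ∫ x in Metric.ball (0 : E) (t * R), f x ∂μ := by
  rw [Measure.setIntegral_comp_smul_of_pos μ f _ ht, smul_ball ht.ne', smul_zero,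
    Real.norm_of_nonneg ht.le, smul_eq_mul]

lemma hasDerivAt_setIntegral_ball_comp_smul {f : E → ℝ} (hf : ContDiff ℝ 1 f) (R t : ℝ) :
    HasDerivAt (fun t : ℝ => ∫ x in Metric.ball (0 : E) R, f (t • x) ∂μ)
      (∫ x in Metric.ball (0 : E) R, fderiv ℝ f (t • x) x ∂μ) t := by
  have hf' : Continuous (fderiv ℝ f) := hf.continuous_fderiv one_ne_zero
  have hF' : Continuous fun p : ℝ × E => fderiv ℝ f (p.1 • p.2) p.2 := by fun_prop
  obtain ⟨M, hM⟩ := ((isCompact_closedBall t 1).prod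
    (isCompact_closedBall (0 : E) R)).exists_bound_of_continuousOn hF'.continuousOn
  refine (hasDerivAt_integral_of_dominated_loc_of_deriv_le
    (F' := fun t x => fderiv ℝ f (t • x) x)
    (bound := fun _ => M) (Metric.closedBall_mem_nhds t one_pos) ?_ ?_ ?_ ?_ ?_ ?_).2
  · have h (s : ℝ) : Continuous fun x : E => f (s • x) :=
      hf.continuous.comp (continuous_const_smul s)
    exact Filter.Eventually.of_forall fun s => (h s).aestronglyMeasurable
  · exact (hf.continuous.comp (continuous_const_smul t)).integrableOn_ball 0 R
  · exact (by fun_prop : Continuous fun x => fderiv ℝ f (t • x) x).aestronglyMeasurable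
  · filter_upwards [ae_restrict_mem Metric.isOpen_ball.measurableSet] with x hx s hs
    exact hM (s, x) ⟨hs, Metric.ball_subset_closedBall hx⟩
  · exact continuous_const.integrableOn_ball 0 R
  · refine Filter.Eventually.of_forall fun x s _ => ?_
    have h := ((hf.differentiable one_ne_zero) (s • x)).hasFDerivAt.comp_hasDerivAt s
      ((hasDerivAt_id s).smul_const x)
    simpa [Function.comp_def] using h

lemma norm_setIntegral_ball_fderiv_comp_smul_le {f : E → ℝ} (hf : ContDiff ℝ 1 f) {R s t : ℝ}
    (hR : 0 < R) (hs : 0 < s) (hst : s ≤ t) (ht : t ≤ 1) :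
    ‖∫ x in Metric.ball (0 : E) R, fderiv ℝ f (t • x) x ∂μ‖
      ≤ (s ^ Module.finrank ℝ E)⁻¹ * (R * ∫ x in Metric.ball (0 : E) R, ‖fderiv ℝ f x‖ ∂μ) := by
  have hf' : Continuous (fderiv ℝ f) := hf.continuous_fderiv one_ne_zero
  have ht0 : 0 < t := hs.trans_le hst
  calc ‖∫ x in Metric.ball (0 : E) R, fderiv ℝ f (t • x) x ∂μ‖
      ≤ ∫ x in Metric.ball (0 : E) R, R * ‖fderiv ℝ f (t • x)‖ ∂μ := by
        refine norm_integral_le_of_norm_le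
          ((by fun_prop : Continuous fun x => R * ‖fderiv ℝ f (t • x)‖).integrableOn_ball 0 R) ?_
        filter_upwards [ae_restrict_mem Metric.isOpen_ball.measurableSet] with x hx
        rw [mul_comm]
        exact (fderiv ℝ f (t • x)).le_opNorm_of_le (mem_ball_zero_iff.1 hx).le
    _ = (t ^ Module.finrank ℝ E)⁻¹
          * (R * ∫ x in Metric.ball (0 : E) (t * R), ‖fderiv ℝ f x‖ ∂μ) := by
        rw [integral_const_mul, setIntegral_ball_comp_smul μ (fun x => ‖fderiv ℝ f x‖) ht0]
        ring
    _ ≤ _ := by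
        gcongr
        · exact Filter.Eventually.of_forall fun x => norm_nonneg _
        · exact hf'.norm.integrableOn_ball 0 R
        · exact mul_le_of_le_one_left hR.le ht

theorem setIntegral_ball_le_of_contDiff {f : E → ℝ} (hf : ContDiff ℝ 1 f) {r R : ℝ}
    (hr : 0 < r) (hrR : r ≤ R) :
    ∫ x in Metric.ball (0 : E) r, f x ∂μ
      ≤ R * (∫ x in Metric.ball (0 : E) R, ‖fderiv ℝ f x‖ ∂μ)
        + (r / R) ^ Module.finrank ℝ E * ∫ x in Metric.ball (0 : E) R, f x ∂μ := by
  have hR : 0 < R := hr.trans_le hrR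
  set s := r / R with hs_def
  have hs : 0 < s := div_pos hr hR
  have hs1 : s ≤ 1 := (div_le_one hR).2 hrR
  have hsR : s * R = r := div_mul_cancel₀ r hR.ne'
  set G := R * ∫ x in Metric.ball (0 : E) R, ‖fderiv ℝ f x‖ ∂μ
  have hG : 0 ≤ G := mul_nonneg hR.le (integral_nonneg fun _ => norm_nonneg _)
  set F : ℝ → ℝ := fun t => ∫ x in Metric.ball (0 : E) R, f (t • x) ∂μ with hF
  have hp : 0 < s ^ Module.finrank ℝ E := pow_pos hs _
  have key : ‖F s - F 1‖ ≤ (s ^ Module.finrank ℝ E)⁻¹ * G * ‖s - 1‖ :=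
    Convex.norm_image_sub_le_of_norm_hasDerivWithin_le (s := Set.Icc s 1)
      (fun t _ => (hasDerivAt_setIntegral_ball_comp_smul μ hf R t).hasDerivWithinAt)
      (fun t ht => norm_setIntegral_ball_fderiv_comp_smul_le μ hf hR hs ht.1 ht.2)
      (convex_Icc s 1) ⟨hs1, le_rfl⟩ ⟨le_rfl, hs1⟩
  have hn : ‖s - 1‖ ≤ 1 := by rw [Real.norm_eq_abs, abs_le]; constructor <;> linarith
  have key' : F s ≤ (s ^ Module.finrank ℝ E)⁻¹ * G + F 1 := by
    have := (Real.le_norm_self _).trans (key.trans (mul_le_of_le_one_right (by positivity) hn))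
    linarith
  have hFs : F s = (s ^ Module.finrank ℝ E)⁻¹ * ∫ x in Metric.ball (0 : E) r, f x ∂μ := by
    rw [hF, ← hsR]
    exact setIntegral_ball_comp_smul μ f hs R
  have hF1 : F 1 = ∫ x in Metric.ball (0 : E) R, f x ∂μ := by simp [hF]
  rw [hFs, hF1] at key'
  have := mul_le_mul_of_nonneg_left key' hp.le
  rwa [mul_add, mul_inv_cancel_left₀ hp.ne', mul_inv_cancel_left₀ hp.ne'] at this

end Dilation

lemma integral_sqrt_mul_sqrt_le {α : Type*} [MeasurableSpace α] {μ : Measure α} {f g : α → ℝ}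
    (hf : 0 ≤ f) (hg : 0 ≤ g) (hfi : Integrable f μ) (hgi : Integrable g μ) :
    ∫ x, √(f x) * √(g x) ∂μ ≤ √(∫ x, f x ∂μ) * √(∫ x, g x ∂μ) := by
  have hL2 {h : α → ℝ} (h0 : 0 ≤ h) (hi : Integrable h μ) :
      MemLp (fun x => √(h x)) (ENNReal.ofReal 2) μ := by
    rw [ENNReal.ofReal_ofNat, memLp_two_iff_integrable_sq
      (Real.continuous_sqrt.comp_aestronglyMeasurable hi.aestronglyMeasurable)]
    simpa only [Real.sq_sqrt (h0 _)] using hi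
  have := integral_mul_le_Lp_mul_Lq_of_nonneg Real.HolderConjugate.two_two
    (Filter.Eventually.of_forall fun x => Real.sqrt_nonneg (f x))
    (Filter.Eventually.of_forall fun x => Real.sqrt_nonneg (g x)) (hL2 hf hfi) (hL2 hg hgi)
  simpa only [Real.rpow_two, Real.sq_sqrt (hf _), Real.sq_sqrt (hg _),
    ← Real.sqrt_eq_rpow] using this

lemma sq_norm_le_sum_sq_single {ι : Type*} [Fintype ι] [DecidableEq ι]
    (L : EuclideanSpace ℝ ι →L[ℝ] ℝ) :
    ‖L‖ ^ 2 ≤ ∑ i, (L (EuclideanSpace.single i 1)) ^ 2 := by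
  have h : ‖L‖ ≤ √(∑ i, (L (EuclideanSpace.single i 1)) ^ 2) := by
    refine L.opNorm_le_bound (Real.sqrt_nonneg _) fun v => ?_
    have hv : L v = ∑ i, L (EuclideanSpace.single i 1) * v i := by
      conv_lhs => rw [← (EuclideanSpace.basisFun ι ℝ).sum_repr v]
      simp [mul_comm]
    rw [hv, EuclideanSpace.norm_eq]
    simp only [Real.norm_eq_abs, sq_abs]
    rw [← Real.sqrt_mul (by positivity)]
    exact Real.abs_le_sqrt (Finset.sum_mul_sq_le_sq_mul_sq _ _ _)
  calc ‖L‖ ^ 2 ≤ √(∑ i, (L (EuclideanSpace.single i 1)) ^ 2) ^ 2 := by gcongr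
    _ = _ := Real.sq_sqrt (by positivity)

lemma norm_fderiv_sum_sq_le {κ : Type*} [Fintype κ] {w : EuclideanSpace ℝ (Fin 3) → κ → ℝ}
    {x : EuclideanSpace ℝ (Fin 3)} (hw : ∀ k, DifferentiableAt ℝ (fun y => w y k) x) :
    ‖fderiv ℝ (fun y => ∑ k, (w y k) ^ 2) x‖
      ≤ 2 * (√(∑ k, (w x k) ^ 2) * √(∑ i, ∑ k, (pd i (fun y => w y k) x) ^ 2)) := by
  have h : HasFDerivAt (fun y => ∑ k, (w y k) ^ 2)
      (∑ k, (2 * w x k) • fderiv ℝ (fun y => w y k) x) x := by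
    refine HasFDerivAt.fun_sum fun k _ => ?_
    simpa using (hw k).hasFDerivAt.pow 2
  rw [h.fderiv]
  calc ‖∑ k, (2 * w x k) • fderiv ℝ (fun y => w y k) x‖
      ≤ ∑ k, ‖(2 * w x k) • fderiv ℝ (fun y => w y k) x‖ := norm_sum_le _ _
    _ = 2 * ∑ k, |w x k| * ‖fderiv ℝ (fun y => w y k) x‖ := by
        rw [Finset.mul_sum]
        refine Finset.sum_congr rfl fun k _ => ?_
        rw [norm_smul, norm_mul, Real.norm_ofNat, Real.norm_eq_abs, mul_assoc]
    _ ≤ 2 * (√(∑ k, |w x k| ^ 2) * √(∑ k, ‖fderiv ℝ (fun y => w y k) x‖ ^ 2)) := by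
        gcongr
        exact Real.sum_mul_le_sqrt_mul_sqrt _ _ _
    _ ≤ _ := by
        simp only [sq_abs]
        gcongr
        rw [Finset.sum_comm]
        exact Finset.sum_le_sum fun k _ => sq_norm_le_sum_sq_single _

lemma setIntegral_ball_sum_sq_le_of_contDiff {m : ℕ} {w : EuclideanSpace ℝ (Fin 3) → Fin m → ℝ}
    (hw : ContDiff ℝ 1 w) {r ρ : ℝ} (hr : 0 < r) (hrρ : r ≤ ρ) :
    (∫ x in Metric.ball (0 : EuclideanSpace ℝ (Fin 3)) r, ∑ k, (w x k) ^ 2)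
      ≤ 2 * (ρ * √(∫ x in Metric.ball (0 : EuclideanSpace ℝ (Fin 3)) ρ, ∑ k, (w x k) ^ 2)
            * √(∫ x in Metric.ball (0 : EuclideanSpace ℝ (Fin 3)) ρ,
                ∑ i, ∑ k, (pd i (fun y => w y k) x) ^ 2)
          + (r / ρ) ^ 3 *
              ∫ x in Metric.ball (0 : EuclideanSpace ℝ (Fin 3)) ρ, ∑ k, (w x k) ^ 2) := by
  have hρ : 0 < ρ := hr.trans_le hrρ
  have hwk (k) : ContDiff ℝ 1 fun y => w y k := contDiff_pi.1 hw k
  have hpd (i k) : Continuous (pd i fun y => w y k) :=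
    ((hwk k).continuous_fderiv one_ne_zero).clm_apply continuous_const
  have hu : ContDiff ℝ 1 fun x => ∑ k, (w x k) ^ 2 := ContDiff.sum fun k _ => (hwk k).pow 2
  have hg : Continuous fun x => ∑ i, ∑ k, (pd i (fun y => w y k) x) ^ 2 := by fun_prop
  have h1 := setIntegral_ball_le_of_contDiff volume hu hr hrρ
  rw [finrank_euclideanSpace_fin] at h1
  have h2 : ∫ x in Metric.ball (0 : EuclideanSpace ℝ (Fin 3)) ρ,
        ‖fderiv ℝ (fun y => ∑ k, (w y k) ^ 2) x‖
      ≤ 2 * (√(∫ x in Metric.ball (0 : EuclideanSpace ℝ (Fin 3)) ρ, ∑ k, (w x k) ^ 2)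
            * √(∫ x in Metric.ball (0 : EuclideanSpace ℝ (Fin 3)) ρ,
                ∑ i, ∑ k, (pd i (fun y => w y k) x) ^ 2)) := by
    refine (integral_mono ((hu.continuous_fderiv one_ne_zero).norm.integrableOn_ball 0 ρ)
      (((hu.continuous.sqrt.mul hg.sqrt).integrableOn_ball 0 ρ).const_mul 2) fun x =>
        norm_fderiv_sum_sq_le fun k => (hwk k).differentiable one_ne_zero x).trans ?_
    rw [integral_const_mul]
    gcongr
    exact integral_sqrt_mul_sqrt_le (fun x => by positivity) (fun x => by positivity)
      (hu.continuous.integrableOn_ball 0 ρ) (hg.integrableOn_ball 0 ρ)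
  have h3 : 0 ≤ (r / ρ) ^ 3 *
      ∫ x in Metric.ball (0 : EuclideanSpace ℝ (Fin 3)) ρ, ∑ k, (w x k) ^ 2 :=
    mul_nonneg (by positivity) (integral_nonneg fun x => by positivity)
  linarith [mul_le_mul_of_nonneg_left h2 hρ.le]

lemma exists_contDiff_eqOn_ball {E F : Type*} [NormedAddCommGroup E] [InnerProductSpace ℝ E]
    [FiniteDimensional ℝ E] [NormedAddCommGroup F] [NormedSpace ℝ F] {n : ℕ∞} {w : E → F}
    {U : Set E} {x : E} {R : ℝ} (hR : 0 < R) (hU : IsOpen U) (hRU : Metric.closedBall x R ⊆ U)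
    (hw : ContDiffOn ℝ n w U) :
    ∃ v : E → F, ContDiff ℝ n v ∧ Set.EqOn v w (Metric.ball x R) := by
  obtain ⟨δ, hδ, hδU⟩ := (isCompact_closedBall x R).exists_cthickening_subset_open hU hRU
  rw [cthickening_closedBall hδ.le hR.le] at hδU
  let χ : ContDiffBump x := ⟨R, δ + R, hR, by linarith⟩
  refine ⟨fun y => χ y • w y, contDiff_iff_contDiffAt.2 fun y => ?_, fun y hy => ?_⟩
  · by_cases hy : y ∈ U
    · exact χ.contDiffAt.smul (hw.contDiffAt (hU.mem_nhds hy))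
    · have hχ : y ∉ tsupport χ := fun h => hy (hδU (χ.tsupport_eq ▸ h))
      refine (contDiffAt_const (c := (0 : F))).congr_of_eventuallyEq ?_
      filter_upwards [notMem_tsupport_iff_eventuallyEq.1 hχ] with z hz
      simp [hz]
  · simp [χ.one_of_mem_closedBall (Metric.ball_subset_closedBall hy)]

/-- Poincaré-type inequality: there is a universal `C > 0` such that for all `0 < r ≤ ρ` and
every `w : ℝ³ → ℝ^m` continuously differentiable on a neighborhood of `B̄_ρ(0)`,
`∫_{B_r}|w|² ≤ C [ ρ (∫_{B_ρ}|w|²)^{1/2} (∫_{B_ρ}|∇w|²)^{1/2} + (r/ρ)³ ∫_{B_ρ}|w|² ]`. -/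
theorem mean_oscillation_ball_estimate :
    ∃ C > 0, ∀ r ρ : ℝ, 0 < r → r ≤ ρ →
      ∀ (m : ℕ) (w : EuclideanSpace ℝ (Fin 3) → (Fin m → ℝ))
        (U : Set (EuclideanSpace ℝ (Fin 3))),
        IsOpen U → Metric.closedBall 0 ρ ⊆ U → ContDiffOn ℝ 1 w U →
        (∫ x in Metric.ball (0 : EuclideanSpace ℝ (Fin 3)) r, ∑ k : Fin m, (w x k) ^ 2)
          ≤ C * (ρ * Real.sqrt (∫ x in Metric.ball (0 : EuclideanSpace ℝ (Fin 3)) ρ,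
                    ∑ k : Fin m, (w x k) ^ 2)
                  * Real.sqrt (∫ x in Metric.ball (0 : EuclideanSpace ℝ (Fin 3)) ρ,
                      ∑ i : Fin 3, ∑ k : Fin m, (pd i (fun y => w y k) x) ^ 2)
                + (r / ρ) ^ 3 *
                    ∫ x in Metric.ball (0 : EuclideanSpace ℝ (Fin 3)) ρ,
                      ∑ k : Fin m, (w x k) ^ 2) := by
  refine ⟨2, two_pos, fun r ρ hr hrρ m w U hU hρU hw => ?_⟩
  obtain ⟨v, hv, hvw⟩ := exists_contDiff_eqOn_ball (hr.trans_le hrρ) hU hρU hw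
  have hpd (i : Fin 3) (k : Fin m) : Set.EqOn (pd i fun y => v y k) (pd i fun y => w y k)
      (Metric.ball 0 ρ) := fun x hx => by
    have : (fun y => v y k) =ᶠ[nhds x] fun y => w y k := by
      filter_upwards [Metric.isOpen_ball.mem_nhds hx] with y hy
      rw [hvw hy]
    rw [pd, pd, this.fderiv_eq]
  have hsq (R : ℝ) (hR : R ≤ ρ) :
      ∫ x in Metric.ball (0 : EuclideanSpace ℝ (Fin 3)) R, ∑ k : Fin m, (w x k) ^ 2
        = ∫ x in Metric.ball (0 : EuclideanSpace ℝ (Fin 3)) R, ∑ k : Fin m, (v x k) ^ 2 :=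
    setIntegral_congr_fun Metric.isOpen_ball.measurableSet fun x hx => by
      simp only [hvw (Metric.ball_subset_ball hR hx)]
  have hgrad : ∫ x in Metric.ball (0 : EuclideanSpace ℝ (Fin 3)) ρ,
        ∑ i : Fin 3, ∑ k : Fin m, (pd i (fun y => w y k) x) ^ 2
      = ∫ x in Metric.ball (0 : EuclideanSpace ℝ (Fin 3)) ρ,
        ∑ i : Fin 3, ∑ k : Fin m, (pd i (fun y => v y k) x) ^ 2 :=
    setIntegral_congr_fun Metric.isOpen_ball.measurableSet fun x hx => by
      simp only [hpd _ _ hx]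
  rw [hsq r hrρ, hsq ρ le_rfl, hgrad]
  exact setIntegral_ball_sum_sq_le_of_contDiff hv hr hrρ
end

section
/- There exists a universal constant C>0 with the following property. Let ρ>0, x₀∈ℝ³, and let p : ℝ³ → ℝ be twice continuously differentiable on a neighborhood of the closed ball of radius ρ centered at x₀ with Δp = 0 on B_ρ(x₀). Then for every 0 < τ ≤ ρ/2, ∫_{B_τ(x₀)}|p|^{3/2} dx ≤ C(τ/ρ)³ ∫_{B_ρ(x₀)}|p|^{3/2} dx. -/
open MeasureTheory

open Metric Set Filter Topology

local notation "ℝ³" => EuclideanSpace ℝ (Fin 3)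

/-- The truncated paraboloid `(1 - |y|²)₊`, used as a radial averaging weight. -/
noncomputable def paraboloid (y : ℝ³) : ℝ := max (1 - ‖y‖ ^ 2) 0

lemma continuous_paraboloid : Continuous paraboloid := by
  unfold paraboloid; fun_prop

lemma paraboloid_nonneg (y : ℝ³) : 0 ≤ paraboloid y := le_max_right _ _

lemma paraboloid_le_one (y : ℝ³) : paraboloid y ≤ 1 :=
  max_le (by linarith [sq_nonneg ‖y‖]) zero_le_one

lemma paraboloid_eq_zero {y : ℝ³} (hy : 1 ≤ ‖y‖) : paraboloid y = 0 :=
  max_eq_right (by nlinarith)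

lemma hasCompactSupport_paraboloid : HasCompactSupport paraboloid :=
  HasCompactSupport.intro (isCompact_closedBall (0 : ℝ³) 1) fun y hy =>
    paraboloid_eq_zero (by simpa using (not_le.1 (mt mem_closedBall.2 hy)).le)

lemma integral_paraboloid_pos : 0 < ∫ y, paraboloid y :=
  continuous_paraboloid.integral_pos_of_hasCompactSupport_nonneg_nonzero
    hasCompactSupport_paraboloid paraboloid_nonneg (x := 0) (by simp [paraboloid])

lemma hasDerivAt_max_zero_sq (u : ℝ) :
    HasDerivAt (fun v : ℝ => max v 0 ^ 2) (2 * max u 0) u := by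
  rcases lt_trichotomy u 0 with h | rfl | h
  · rw [max_eq_right h.le, mul_zero]
    refine (hasDerivAt_const u (0 : ℝ)).congr_of_eventuallyEq ?_
    filter_upwards [eventually_lt_nhds h] with v hv
    simp [max_eq_right hv.le]
  · rw [hasDerivAt_iff_isLittleO]
    refine (Asymptotics.IsBigO.of_bound 1 ?_).trans_isLittleO
      (Asymptotics.isLittleO_pow_id (𝕜 := ℝ) (n := 2) one_lt_two) |>.congr_right (by simp)
    refine Eventually.of_forall fun v => ?_
    rcases le_total v 0 with hv | hv <;> simp [hv, sq_nonneg]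
  · rw [max_eq_left h.le]
    have := hasDerivAt_pow 2 u
    refine (this.congr_of_eventuallyEq ?_).congr_deriv (by simp)
    filter_upwards [eventually_gt_nhds h] with v hv
    simp [max_eq_left hv.le]

lemma hasFDerivAt_paraboloid_sq (y : ℝ³) :
    HasFDerivAt (fun z => paraboloid z ^ 2) ((-4 * paraboloid y) • innerSL ℝ y) y := by
  have h1 : HasFDerivAt (fun z : ℝ³ => 1 - ‖z‖ ^ 2) (-(2 • innerSL ℝ y)) y :=
    (hasStrictFDerivAt_norm_sq y).hasFDerivAt.const_sub 1
  refine ((hasDerivAt_max_zero_sq (1 - ‖y‖ ^ 2)).comp_hasFDerivAt y h1).congr_fderiv ?_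
  ext v
  simp [paraboloid]
  ring

lemma hasFDerivAt_comp_add_smul {g : ℝ³ → ℝ} (hg : Differentiable ℝ g) (x y : ℝ³) (t : ℝ) :
    HasFDerivAt (fun z => g (x + t • z)) (t • fderiv ℝ g (x + t • y)) y := by
  have h : HasFDerivAt (fun z : ℝ³ => x + t • z) (t • ContinuousLinearMap.id ℝ ℝ³) y :=
    ((hasFDerivAt_id y).const_smul t).const_add x
  refine ((hg (x + t • y)).hasFDerivAt.comp y h).congr_fderiv ?_
  ext v
  simp

/-- Integration by parts against the radial weight: `-4 w(y) yᵢ = ∂ᵢ (w²)`. -/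
lemma integral_paraboloid_mul_coord {g : ℝ³ → ℝ} (hg : ContDiff ℝ 1 g) (x : ℝ³) (t : ℝ)
    (i : Fin 3) :
    4 * ∫ y, paraboloid y * (y i * g (x + t • y)) =
      t * ∫ y, paraboloid y ^ 2 * pd i g (x + t • y) := by
  have hgc := hg.continuous
  have hg'c : Continuous (pd i g) := (hg.continuous_fderiv one_ne_zero).clm_apply continuous_const
  have hgd := hg.differentiable one_ne_zero
  have hw := continuous_paraboloid
  have hs := hasCompactSupport_paraboloid
  have hs2 : HasCompactSupport fun y => paraboloid y ^ 2 :=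
    hs.comp_left (g := fun u : ℝ => u ^ 2) (by simp)
  have e1 : ∀ y, fderiv ℝ (fun z => paraboloid z ^ 2) y (EuclideanSpace.single i 1) =
      paraboloid y * (-4 * y i) := fun y => by
    rw [(hasFDerivAt_paraboloid_sq y).fderiv]
    simp [EuclideanSpace.inner_single_right]
    ring
  have e2 : ∀ y, fderiv ℝ (fun z => g (x + t • z)) y (EuclideanSpace.single i 1) =
      t * pd i g (x + t • y) := fun y => by
    rw [(hasFDerivAt_comp_add_smul hgd x y t).fderiv]
    simp [pd]
  have := integral_mul_fderiv_eq_neg_fderiv_mul_of_integrable (μ := volume)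
    (f := fun z => paraboloid z ^ 2) (g := fun z => g (x + t • z))
    (v := EuclideanSpace.single i (1 : ℝ)) ?_ ?_ ?_
    (fun y _ => (hasFDerivAt_paraboloid_sq y).differentiableAt)
    (fun y _ => (hasFDerivAt_comp_add_smul hgd x y t).differentiableAt)
  · simp only [e1, e2] at this
    calc
      _ = -∫ y, paraboloid y * (-4 * y i) * g (x + t • y) := by
        rw [← integral_const_mul, ← integral_neg]
        exact integral_congr_ae (Eventually.of_forall fun y => by ring)
      _ = ∫ y, paraboloid y ^ 2 * (t * pd i g (x + t • y)) := this.symm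
      _ = _ := by
        rw [← integral_const_mul]
        exact integral_congr_ae (Eventually.of_forall fun y => by ring)
  · simp only [e1]
    exact Continuous.integrable_of_hasCompactSupport (by fun_prop) hs.mul_right.mul_right
  · simp only [e2]
    exact Continuous.integrable_of_hasCompactSupport (by fun_prop) hs2.mul_right
  · exact Continuous.integrable_of_hasCompactSupport (by fun_prop) hs2.mul_right

lemma fderiv_apply_eq_sum_pd (q : ℝ³ → ℝ) (z y : ℝ³) :
    fderiv ℝ q z y = ∑ i, y i * pd i q z := by
  conv_lhs => rw [← (EuclideanSpace.basisFun (Fin 3) ℝ).sum_repr y]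
  simp [pd]

lemma contDiff_pd {q : ℝ³ → ℝ} (hq : ContDiff ℝ 2 q) (i : Fin 3) : ContDiff ℝ 1 (pd i q) :=
  (hq.fderiv_right (m := 1) (by norm_num)).clm_apply contDiff_const

/-- Weighted solid mean value property. -/
lemma integral_paraboloid_mul_of_harmonic {q : ℝ³ → ℝ} (hq : ContDiff ℝ 2 q)
    (hqs : HasCompactSupport q) {x : ℝ³} {s : ℝ} (hs : 0 < s)
    (hΔ : ∀ z ∈ ball x s, ∑ i : Fin 3, pd i (pd i q) z = 0) :
    ∫ y, paraboloid y * q (x + s • y) = (∫ y, paraboloid y) * q x := by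
  have hw := continuous_paraboloid
  have hws := hasCompactSupport_paraboloid
  have hqc := hq.continuous
  have hfc : Continuous (fderiv ℝ q) := hq.continuous_fderiv two_ne_zero
  have hws2 : HasCompactSupport fun y => paraboloid y ^ 2 :=
    hws.comp_left (g := fun u : ℝ => u ^ 2) (by simp)
  obtain ⟨M, hM⟩ := (hqs.fderiv (𝕜 := ℝ)).exists_bound_of_continuous hfc
  have hderiv : ∀ t, HasDerivAt (fun t : ℝ => ∫ y, paraboloid y * q (x + t • y))
      (∫ y, paraboloid y * fderiv ℝ q (x + t • y) y) t := fun t => by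
    refine (hasDerivAt_integral_of_dominated_loc_of_deriv_le (s := univ)
      (F' := fun t y => paraboloid y * fderiv ℝ q (x + t • y) y)
      (bound := fun y => paraboloid y * (M * ‖y‖)) univ_mem ?_ ?_ ?_ ?_ ?_ ?_).2
    · exact Eventually.of_forall fun t => Continuous.aestronglyMeasurable (by fun_prop)
    · exact Continuous.integrable_of_hasCompactSupport (by fun_prop) hws.mul_right
    · exact Continuous.aestronglyMeasurable (by fun_prop)
    · refine Eventually.of_forall fun y t _ => ?_
      rw [norm_mul, Real.norm_of_nonneg (paraboloid_nonneg y)]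
      exact mul_le_mul_of_nonneg_left ((fderiv ℝ q _).le_of_opNorm_le (hM _) y)
        (paraboloid_nonneg y)
    · exact Continuous.integrable_of_hasCompactSupport (by fun_prop) hws.mul_right
    · refine Eventually.of_forall fun y t _ => ?_
      have h : HasDerivAt (fun t : ℝ => x + t • y) y t := by
        simpa using ((hasDerivAt_id t).smul_const y).const_add x
      exact ((hq.differentiable two_ne_zero _).hasFDerivAt.comp_hasDerivAt t h).const_mul _
  have hzero : ∀ t ∈ Ico 0 s, ∫ y, paraboloid y * fderiv ℝ q (x + t • y) y = 0 := by
    intro t ht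
    have hpc : ∀ i, Continuous (pd i q) := fun i => (contDiff_pd hq i).continuous
    have hppc : ∀ i, Continuous (pd i (pd i q)) := fun i =>
      ((contDiff_pd hq i).continuous_fderiv one_ne_zero).clm_apply continuous_const
    have h4 : 4 * ∫ y, paraboloid y * fderiv ℝ q (x + t • y) y =
        t * ∫ y, paraboloid y ^ 2 * ∑ i, pd i (pd i q) (x + t • y) := by
      simp only [fderiv_apply_eq_sum_pd, Finset.mul_sum]
      rw [integral_finsetSum, integral_finsetSum, Finset.mul_sum, Finset.mul_sum]
      · exact Finset.sum_congr rfl fun i _ =>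
          integral_paraboloid_mul_coord (contDiff_pd hq i) x t i
      · intro i _
        have := hppc i
        exact Continuous.integrable_of_hasCompactSupport (by fun_prop) hws2.mul_right
      · intro i _
        have := hpc i
        exact Continuous.integrable_of_hasCompactSupport (by fun_prop) hws.mul_right
    have h0 : ∫ y, paraboloid y ^ 2 * ∑ i, pd i (pd i q) (x + t • y) = 0 := by
      refine integral_eq_zero_of_ae (Eventually.of_forall fun y => ?_)
      rcases le_or_gt 1 ‖y‖ with hy | hy
      · simp [paraboloid_eq_zero hy]
      · have : x + t • y ∈ ball x s := by
          rw [mem_ball, dist_eq_norm, add_sub_cancel_left, norm_smul, Real.norm_of_nonneg ht.1]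
          nlinarith [ht.1, ht.2, norm_nonneg y]
        simp [hΔ _ this]
    rw [h0] at h4
    linarith
  have := constant_of_has_deriv_right_zero (a := 0) (b := s)
    (f := fun t : ℝ => ∫ y, paraboloid y * q (x + t • y))
    (fun t _ => (hderiv t).continuousAt.continuousWithinAt)
    (fun t ht => (hzero t ht ▸ hderiv t).hasDerivWithinAt) s ⟨hs.le, le_rfl⟩
  simpa [integral_mul_const] using this

lemma sqrt_mul_le_three_halves {A a : ℝ} (hA : 0 ≤ A) (ha : 0 ≤ a) :
    A ^ ((1 : ℝ) / 2) * a ≤ A ^ ((3 : ℝ) / 2) / 3 + 2 / 3 * a ^ ((3 : ℝ) / 2) := by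
  have h : (3 : ℝ).HolderConjugate (3 / 2) := by
    rw [Real.holderConjugate_iff]; norm_num
  have := Real.young_inequality_of_nonneg (Real.rpow_nonneg hA (1 / 2)) ha h
  rw [← Real.rpow_mul hA] at this
  norm_num at this ⊢
  linarith

lemma pointwise_three_halves_le {q : ℝ³ → ℝ} (hq : ContDiff ℝ 2 q)
    (hqs : HasCompactSupport q) {x : ℝ³} {s : ℝ} (hs : 0 < s)
    (hΔ : ∀ z ∈ ball x s, ∑ i : Fin 3, pd i (pd i q) z = 0) :
    (∫ y, paraboloid y) * |q x| ^ ((3 : ℝ) / 2) ≤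
      (s ^ 3)⁻¹ * ∫ z in ball x s, |q z| ^ ((3 : ℝ) / 2) := by
  have hw := continuous_paraboloid
  have hws := hasCompactSupport_paraboloid
  have hqc := hq.continuous
  have hpow : Continuous fun z => |q z| ^ ((3 : ℝ) / 2) :=
    hqc.abs.rpow_const fun _ => Or.inr (by norm_num)
  set κ := ∫ y, paraboloid y with hκ
  have hκ0 : 0 < κ := integral_paraboloid_pos
  have hI1 : Integrable fun y => paraboloid y * |q (x + s • y)| :=
    Continuous.integrable_of_hasCompactSupport (by fun_prop) hws.mul_right
  have hc2 : Continuous fun y => paraboloid y * |q (x + s • y)| ^ ((3 : ℝ) / 2) :=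
    hw.mul (hpow.comp (by fun_prop : Continuous fun y : ℝ³ => x + s • y))
  have hI2 : Integrable fun y => paraboloid y * |q (x + s • y)| ^ ((3 : ℝ) / 2) :=
    hc2.integrable_of_hasCompactSupport hws.mul_right
  have hI0 : Integrable paraboloid := hw.integrable_of_hasCompactSupport hws
  have h1 : κ * |q x| ≤ ∫ y, paraboloid y * |q (x + s • y)| := by
    have := norm_integral_le_integral_norm (μ := volume) fun y => paraboloid y * q (x + s • y)
    rw [integral_paraboloid_mul_of_harmonic hq hqs hs hΔ] at this
    simpa only [norm_mul, Real.norm_eq_abs, abs_of_pos hκ0, abs_of_nonneg (paraboloid_nonneg _),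
      ← hκ] using this
  have hA : |q x| ^ ((1 : ℝ) / 2) * |q x| = |q x| ^ ((3 : ℝ) / 2) := by
    rw [← Real.rpow_add_one' (abs_nonneg _) (by norm_num)]
    norm_num
  have h2 : κ * |q x| ^ ((3 : ℝ) / 2) ≤
      ∫ y, paraboloid y * |q (x + s • y)| ^ ((3 : ℝ) / 2) := by
    have h3 : |q x| ^ ((1 : ℝ) / 2) * ∫ y, paraboloid y * |q (x + s • y)| ≤
        κ * (|q x| ^ ((3 : ℝ) / 2) / 3) +
          2 / 3 * ∫ y, paraboloid y * |q (x + s • y)| ^ ((3 : ℝ) / 2) := by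
      rw [← integral_const_mul, ← integral_const_mul, hκ, ← integral_mul_const,
        ← integral_add (hI0.mul_const _) (hI2.const_mul _)]
      refine integral_mono (hI1.const_mul _) ((hI0.mul_const _).add (hI2.const_mul _)) fun y => ?_
      have := mul_le_mul_of_nonneg_left
        (sqrt_mul_le_three_halves (abs_nonneg (q x)) (abs_nonneg (q (x + s • y))))
        (paraboloid_nonneg y)
      simp only
      linarith
    have h4 := mul_le_mul_of_nonneg_left h1 (Real.rpow_nonneg (abs_nonneg (q x)) (1 / 2))
    have h5 : |q x| ^ ((1 : ℝ) / 2) * (κ * |q x|) = κ * |q x| ^ ((3 : ℝ) / 2) := by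
      rw [← hA]; ring
    linarith
  refine h2.trans ?_
  have h6 : ∫ y, paraboloid y * |q (x + s • y)| ^ ((3 : ℝ) / 2) ≤
      ∫ y, (ball x s).indicator (fun z => |q z| ^ ((3 : ℝ) / 2)) (x + s • y) := by
    have hmeas : MeasurableSet ((fun y : ℝ³ => x + s • y) ⁻¹' ball x s) :=
      measurableSet_ball.preimage (by fun_prop : Continuous fun y : ℝ³ => x + s • y).measurable
    have hpre : (fun y : ℝ³ => x + s • y) ⁻¹' ball x s = ball 0 1 := by
      ext y
      simp [dist_eq_norm, norm_smul, abs_of_pos hs, hs]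
    refine integral_mono hI2 ?_ fun y => ?_
    · have : (fun y => (ball x s).indicator (fun z => |q z| ^ ((3 : ℝ) / 2)) (x + s • y)) =
          (ball (0 : ℝ³) 1).indicator (fun y => |q (x + s • y)| ^ ((3 : ℝ) / 2)) := by
        rw [← hpre]; rfl
      rw [this, integrable_indicator_iff measurableSet_ball]
      exact ((hpow.comp (by fun_prop : Continuous fun y : ℝ³ => x + s • y)).continuousOn.integrableOn_compact
        (isCompact_closedBall 0 1)).mono_set ball_subset_closedBall
    · have hn := Real.rpow_nonneg (abs_nonneg (q (x + s • y))) (3 / 2)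
      by_cases hy : x + s • y ∈ ball x s
      · simp only [indicator_of_mem hy]
        exact mul_le_of_le_one_left hn (paraboloid_le_one y)
      · have : 1 ≤ ‖y‖ := by
          have : y ∉ ball (0 : ℝ³) 1 := hpre ▸ hy
          simpa using this
        simp [paraboloid_eq_zero this, indicator_of_notMem hy]
  refine h6.trans_eq ?_
  rw [Measure.integral_comp_smul volume
      (fun y => (ball x s).indicator (fun z => |q z| ^ ((3 : ℝ) / 2)) (x + y)) s,
    integral_add_left_eq_self, integral_indicator measurableSet_ball, finrank_euclideanSpace_fin,
    abs_of_pos (by positivity), smul_eq_mul]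

lemma exists_contDiff_hasCompactSupport_eqOn {p : ℝ³ → ℝ} {U : Set ℝ³} {x₀ : ℝ³} {ρ : ℝ}
    (hρ : 0 < ρ) (hU : IsOpen U) (hsub : closedBall x₀ ρ ⊆ U) (hp : ContDiffOn ℝ 2 p U) :
    ∃ q : ℝ³ → ℝ, ContDiff ℝ 2 q ∧ HasCompactSupport q ∧ EqOn q p (closedBall x₀ ρ) := by
  obtain ⟨δ, hδ, hδU⟩ := (isCompact_closedBall x₀ ρ).exists_cthickening_subset_open hU hsub
  rw [cthickening_closedBall hδ.le hρ.le] at hδU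
  let χ : ContDiffBump x₀ := ⟨ρ, δ + ρ, hρ, by linarith⟩
  refine ⟨fun x => χ x * p x, contDiff_iff_contDiffAt.2 fun x => ?_,
    χ.hasCompactSupport.mul_right, fun x hx => by simp [χ.one_of_mem_closedBall hx]⟩
  by_cases hx : x ∈ U
  · exact χ.contDiffAt.mul (hp.contDiffAt (hU.mem_nhds hx))
  · have hx' : x ∉ tsupport χ := by
      rw [χ.tsupport_eq]
      exact fun h => hx (hδU h)
    refine (contDiffAt_const (c := (0 : ℝ))).congr_of_eventuallyEq ?_
    filter_upwards [notMem_tsupport_iff_eventuallyEq.1 hx'] with y hy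
    simp [hy]

lemma pd_eventuallyEq {f g : ℝ³ → ℝ} {x : ℝ³} (h : f =ᶠ[𝓝 x] g) (i : Fin 3) :
    pd i f =ᶠ[𝓝 x] pd i g :=
  (h.fderiv (𝕜 := ℝ)).mono fun y hy => by simp [pd, hy]

/-- Interior estimate for harmonic functions: there is a universal `C > 0` such that if
`p` is `C²` on a neighborhood of `B̄_ρ(x₀)` and harmonic on `B_ρ(x₀)`, then for all
`0 < τ ≤ ρ/2` one has `∫_{B_τ(x₀)} |p|^{3/2} ≤ C (τ/ρ)³ ∫_{B_ρ(x₀)} |p|^{3/2}`. -/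
theorem harmonic_interior_three_halves_estimate :
    ∃ C > 0, ∀ ρ : ℝ, 0 < ρ →
      ∀ (x₀ : EuclideanSpace ℝ (Fin 3)) (p : EuclideanSpace ℝ (Fin 3) → ℝ)
        (U : Set (EuclideanSpace ℝ (Fin 3))),
        IsOpen U → Metric.closedBall x₀ ρ ⊆ U → ContDiffOn ℝ 2 p U →
        (∀ x ∈ Metric.ball x₀ ρ, ∑ i : Fin 3, pd i (pd i p) x = 0) →
        ∀ τ : ℝ, 0 < τ → τ ≤ ρ / 2 →
          (∫ x in Metric.ball x₀ τ, |p x| ^ ((3 : ℝ) / 2))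
            ≤ C * (τ / ρ) ^ 3 * ∫ x in Metric.ball x₀ ρ, |p x| ^ ((3 : ℝ) / 2) := by
  have hκ := integral_paraboloid_pos
  have hv : 0 < volume.real (ball (0 : ℝ³) 1) :=
    ENNReal.toReal_pos (measure_ball_pos _ _ one_pos).ne' measure_ball_lt_top.ne
  refine ⟨8 * volume.real (ball (0 : ℝ³) 1) / ∫ y, paraboloid y, by positivity, ?_⟩
  intro ρ hρ x₀ p U hU hsub hp hΔ τ hτ hτρ
  obtain ⟨q, hq, hqs, hqp⟩ := exists_contDiff_hasCompactSupport_eqOn hρ hU hsub hp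
  have hqp' : EqOn q p (ball x₀ ρ) := hqp.mono ball_subset_closedBall
  have hqΔ : ∀ x ∈ ball x₀ ρ, ∑ i : Fin 3, pd i (pd i q) x = 0 := fun x hx => by
    rw [← hΔ x hx]
    have h : q =ᶠ[𝓝 x] p := hqp'.eventuallyEq_of_mem (isOpen_ball.mem_nhds hx)
    exact Finset.sum_congr rfl fun i _ => (pd_eventuallyEq (pd_eventuallyEq h i) i).eq_of_nhds
  have hpow : Continuous fun z => |q z| ^ ((3 : ℝ) / 2) :=
    hq.continuous.abs.rpow_const fun _ => Or.inr (by norm_num)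
  have hτsub : ball x₀ τ ⊆ ball x₀ ρ := ball_subset_ball (by linarith)
  rw [setIntegral_congr_fun (g := fun z => |q z| ^ ((3 : ℝ) / 2)) measurableSet_ball
      fun z hz => by simp only [hqp' (hτsub hz)],
    setIntegral_congr_fun (s := ball x₀ ρ) (g := fun z => |q z| ^ ((3 : ℝ) / 2)) measurableSet_ball
      fun z hz => by simp only [hqp' hz]]
  set I := ∫ z in ball x₀ ρ, |q z| ^ ((3 : ℝ) / 2) with hI
  set κ := ∫ y, paraboloid y
  have hbound : ∀ x ∈ ball x₀ τ,
      ‖|q x| ^ ((3 : ℝ) / 2)‖ ≤ ((ρ / 2) ^ 3)⁻¹ * I / κ := fun x hx => by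
    have hxsub : ball x (ρ / 2) ⊆ ball x₀ ρ :=
      ball_subset_ball' (by linarith [mem_ball.1 hx])
    rw [Real.norm_of_nonneg (by positivity), le_div_iff₀ hκ, mul_comm]
    refine (pointwise_three_halves_le hq hqs (half_pos hρ) fun z hz => hqΔ z (hxsub hz)).trans ?_
    refine mul_le_mul_of_nonneg_left ?_ (by positivity)
    exact setIntegral_mono_set ((hpow.continuousOn.integrableOn_compact
      (isCompact_closedBall x₀ ρ)).mono_set ball_subset_closedBall)
      (Eventually.of_forall fun z => by positivity) hxsub.eventuallyLE
  have hfin := (le_abs_self _).trans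
    (norm_setIntegral_le_of_norm_le_const (measure_ball_lt_top (μ := volume)) hbound)
  refine hfin.trans_eq ?_
  have hvol : volume.real (ball x₀ τ) = τ ^ 3 * volume.real (ball (0 : ℝ³) 1) := by
    simp [measureReal_def, Measure.addHaar_ball _ x₀ hτ.le, ENNReal.toReal_mul,
      ENNReal.toReal_ofReal (pow_nonneg hτ.le 3)]
  rw [hvol]
  field_simp
  ring
end
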